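/- arXiv:2404.13980 — 2 statements merged into one kernel-verified Lean document; each statement's English description precedes it below -/
import Mathlib

section
/- For every y ∈ ℝ, −2Q′(y)·∫₀^y A(z)·Q(z)³·ln(Q(z)) dz + A(y)·(Q(y)⁴·ln(Q(y))/2 − Q(y)⁴/8) = Q(y)/4 − Q(y)·ln(Q(y)) + y·Q′(y). -/
open MeasureTheory

/-- The cubic NLS soliton profile. -/
noncomputable def Q (y : ℝ) : ℝ := Real.sqrt 2 / Real.cosh y

/-- The explicit odd-growth solution of the linearized equation. -/
noncomputable def A (y : ℝ) : ℝ :=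
  (Real.sqrt 2 / (4 * Real.cosh y)) * (3 * y * Real.tanh y + (Real.sinh y) ^ 2 - 2)

lemma Q_pos (y : ℝ) : 0 < Q y :=
  div_pos (Real.sqrt_pos.2 two_pos) (Real.cosh_pos y)

lemma hasDerivAt_Q (y : ℝ) :
    HasDerivAt Q (-(Real.sqrt 2 * Real.sinh y / Real.cosh y ^ 2)) y := by
  have h := (hasDerivAt_const y (Real.sqrt 2)).div (Real.hasDerivAt_cosh y) (Real.cosh_pos y).ne'
  refine HasDerivAt.congr_deriv (f := Q) h ?_
  ring

lemma A_mul_Q_pow_three (y : ℝ) :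
    A y * Q y ^ 3 = (3 * y * Real.sinh y / Real.cosh y + Real.cosh y ^ 2 - 3) / Real.cosh y ^ 4 := by
  have hc := (Real.cosh_pos y).ne'
  have h2 : Real.sqrt 2 ^ 2 = 2 := Real.sq_sqrt zero_le_two
  have h4 : Real.sqrt 2 ^ 4 = 4 := by rw [show 4 = 2 * 2 from rfl, pow_mul, h2]; norm_num
  rw [A, Q, Real.tanh_eq_sinh_div_cosh, Real.sinh_sq]
  field_simp
  rw [h4]
  ring

/-- An antiderivative of `-(A * Q ^ 3)`. -/
noncomputable def negPrimitive (y : ℝ) : ℝ :=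
  (2 * Real.cosh y ^ 2 + 3) * Real.sinh y / (4 * Real.cosh y ^ 3) + 3 * y / (4 * Real.cosh y ^ 4)

lemma hasDerivAt_negPrimitive (y : ℝ) :
    HasDerivAt negPrimitive (-(A y * Q y ^ 3)) y := by
  have hc := (Real.cosh_pos y).ne'
  have hC := Real.hasDerivAt_cosh y
  have h := ((((hC.pow 2).const_mul 2).add_const 3).mul (Real.hasDerivAt_sinh y)).div
    ((hC.pow 3).const_mul 4) (mul_ne_zero four_ne_zero (pow_ne_zero 3 hc)) |>.add
    (((hasDerivAt_id y).const_mul 3).div ((hC.pow 4).const_mul 4) (mul_ne_zero four_ne_zero (pow_ne_zero 4 hc)))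
  refine HasDerivAt.congr_deriv (f := negPrimitive) h ?_
  rw [A_mul_Q_pow_three]
  simp only [Pi.mul_apply, Pi.pow_apply, id]
  field_simp
  ring_nf
  simp only [Real.sinh_sq]
  ring

lemma hasDerivAt_log_Q (y : ℝ) :
    HasDerivAt (fun z => Real.log (Q z)) (-(Real.sinh y / Real.cosh y)) y := by
  refine ((hasDerivAt_Q y).log (Q_pos y).ne').congr_deriv ?_
  have hc := (Real.cosh_pos y).ne'
  have h2 : Real.sqrt 2 ≠ 0 := by positivity
  rw [Q]
  field_simp

lemma hasDerivAt_primitive (y : ℝ) :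
    HasDerivAt (fun z => negPrimitive z / 4 - Real.log (Q z) * negPrimitive z - z / 2)
      (A y * Q y ^ 3 * Real.log (Q y)) y := by
  have hc := (Real.cosh_pos y).ne'
  have hG := hasDerivAt_negPrimitive y
  refine (((hG.div_const 4).sub ((hasDerivAt_log_Q y).mul hG)).sub
    ((hasDerivAt_id y).div_const 2)).congr_deriv ?_
  rw [A_mul_Q_pow_three, negPrimitive]
  field_simp
  ring_nf
  simp only [Real.sinh_sq]
  ring

lemma integral_A_mul_Q_pow_three_mul_log (y : ℝ) :
    ∫ z in (0:ℝ)..y, A z * Q z ^ 3 * Real.log (Q z)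
      = negPrimitive y / 4 - Real.log (Q y) * negPrimitive y - y / 2 := by
  have hcont : Continuous fun z => A z * Q z ^ 3 * Real.log (Q z) := by
    have hlog : Continuous fun z => Real.log (Q z) :=
      continuous_iff_continuousAt.2 fun z => (hasDerivAt_log_Q z).continuousAt
    simp only [A_mul_Q_pow_three]
    refine Continuous.mul ?_ hlog
    fun_prop (disch := intro x; exact (by have := Real.cosh_pos x; positivity))
  rw [intervalIntegral.integral_eq_sub_of_hasDerivAt (fun z _ => hasDerivAt_primitive z)
    (hcont.intervalIntegrable 0 y)]
  simp [negPrimitive]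

theorem stmt10 :
    ∀ y : ℝ,
      -2 * deriv Q y * (∫ z in (0:ℝ)..y, A z * (Q z) ^ 3 * Real.log (Q z))
        + A y * ((Q y) ^ 4 * Real.log (Q y) / 2 - (Q y) ^ 4 / 8)
      = Q y / 4 - Q y * Real.log (Q y) + y * deriv Q y := by
  intro y
  rw [integral_A_mul_Q_pow_three_mul_log, (hasDerivAt_Q y).deriv]
  generalize Real.log (Q y) = L
  have hc := (Real.cosh_pos y).ne'
  have hA : A y * (Q y ^ 4 * L / 2 - Q y ^ 4 / 8) = A y * Q y ^ 3 * (Q y * (L / 2 - 1 / 8)) := by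
    ring
  rw [hA, A_mul_Q_pow_three, negPrimitive, Q]
  field_simp
  ring_nf
  simp only [Real.sinh_sq]
  ring
end

section
/- For every integer k ≥ 1: r_{k+2} = (2/(k(k+1)))·((k²−3)·r_k − 2k·s_k − p_{k+2}/2) and s_{k+2} = (2/((k+1)(k+2)))·((k²−3)·s_k + 2k·r_k − (k+1)·r_{k+2} + p_{k+2}/(2(k+2))). -/
open MeasureTheory

/-- `t₂ y = -(√2/8) ∫ e^{-√2|y-z|} Q(z)² dz`. -/
noncomputable def t2 (y : ℝ) : ℝ :=
  -(Real.sqrt 2 / 8) * ∫ z : ℝ, Real.exp (-(Real.sqrt 2) * |y - z|) * (Q z) ^ 2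

/-- `p k = ∫ Q^k cos`. -/
noncomputable def p (k : ℕ) : ℝ := ∫ y : ℝ, (Q y) ^ k * Real.cos y

/-- `r k = ∫ t₂ Q^k cos`. -/
noncomputable def r (k : ℕ) : ℝ := ∫ y : ℝ, t2 y * (Q y) ^ k * Real.cos y

/-- `s k = ∫ t₂ Q' Q^{k-1} sin`. -/
noncomputable def s (k : ℕ) : ℝ := ∫ y : ℝ, t2 y * deriv Q y * (Q y) ^ (k - 1) * Real.sin y

lemma tanh_sq_eq (y : ℝ) : Real.tanh y ^ 2 = 1 - Q y ^ 2 / 2 := by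
  have hc := (Real.cosh_pos y).ne'
  rw [Real.tanh_eq_sinh_div_cosh, Q, div_pow, div_pow, Real.sq_sqrt zero_le_two]
  field_simp
  linarith [Real.cosh_sq y]

lemma hasDerivAt_tanh_Q (y : ℝ) : HasDerivAt Real.tanh (Q y ^ 2 / 2) y := by
  have hc := (Real.cosh_pos y).ne'
  have h := (Real.hasDerivAt_sinh y).div (Real.hasDerivAt_cosh y) hc
  have hT : Real.tanh = Real.sinh / Real.cosh := funext Real.tanh_eq_sinh_div_cosh
  rw [hT]
  refine h.congr_deriv ?_
  rw [Q, div_pow, Real.sq_sqrt zero_le_two]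
  field_simp
  linarith [Real.cosh_sq y]

lemma hasDerivAt_Q_s15 (y : ℝ) : HasDerivAt Q (-(Q y * Real.tanh y)) y := by
  have hc := (Real.cosh_pos y).ne'
  have h := (hasDerivAt_const y (Real.sqrt 2)).div (Real.hasDerivAt_cosh y) hc
  refine h.congr_deriv ?_
  rw [Q, Real.tanh_eq_sinh_div_cosh]
  field_simp
  ring

lemma hasDerivAt_Q_pow (k : ℕ) (y : ℝ) :
    HasDerivAt (fun y => Q y ^ k) (-(k * (Q y ^ k * Real.tanh y))) y := by
  refine ((hasDerivAt_Q_s15 y).fun_pow k).congr_deriv ?_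
  cases k with
  | zero => simp
  | succ n => simp only [Nat.add_sub_cancel]; ring

lemma continuous_Q : Continuous Q :=
  continuous_iff_continuousAt.2 fun y => (hasDerivAt_Q_s15 y).continuousAt

lemma continuous_tanh_real : Continuous Real.tanh :=
  continuous_iff_continuousAt.2 fun y => (hasDerivAt_tanh_Q y).continuousAt

lemma Q_le_sqrt_two (y : ℝ) : Q y ≤ Real.sqrt 2 :=
  div_le_self (Real.sqrt_nonneg 2) (Real.one_le_cosh y)

lemma integrable_Q : Integrable Q := by
  refine (integrable_inv_one_add_sq.const_mul (4 * Real.sqrt 2)).mono'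
    continuous_Q.aestronglyMeasurable (.of_forall fun y => ?_)
  have h := Real.quadratic_le_exp_of_nonneg (abs_nonneg y)
  have hc : (1 + y ^ 2) / 4 ≤ Real.cosh y := by
    rw [← Real.cosh_abs, Real.cosh_eq]
    have := Real.exp_pos (-|y|)
    rw [sq_abs] at h
    nlinarith [abs_nonneg y]
  rw [Real.norm_of_nonneg (Q_pos y).le, Q]
  calc Real.sqrt 2 / Real.cosh y ≤ Real.sqrt 2 / ((1 + y ^ 2) / 4) := by gcongr
    _ = 4 * Real.sqrt 2 * (1 + y ^ 2)⁻¹ := by field_simp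

lemma integrable_Q_pow_mul {k : ℕ} (hk : 1 ≤ k) {b : ℝ → ℝ} (hb : Continuous b)
    (hb1 : ∀ y, |b y| ≤ 1) : Integrable fun y => Q y ^ k * b y := by
  obtain ⟨n, rfl⟩ := Nat.exists_eq_add_of_le' hk
  refine (integrable_Q.const_mul (Real.sqrt 2 ^ n)).mono'
    ((continuous_Q.pow _).mul hb).aestronglyMeasurable (.of_forall fun y => ?_)
  have hQ := Q_pos y
  rw [Real.norm_eq_abs, abs_mul, abs_of_pos (pow_pos hQ _), pow_succ]
  refine (mul_le_of_le_one_right (by positivity) (hb1 y)).trans ?_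
  gcongr
  exact Q_le_sqrt_two y

lemma integrable_Q_pow_mul_cos {k : ℕ} (hk : 1 ≤ k) :
    Integrable fun y => Q y ^ k * Real.cos y :=
  integrable_Q_pow_mul hk Real.continuous_cos Real.abs_cos_le_one

lemma integrable_Q_pow_mul_sin {k : ℕ} (hk : 1 ≤ k) :
    Integrable fun y => Q y ^ k * Real.sin y :=
  integrable_Q_pow_mul hk Real.continuous_sin Real.abs_sin_le_one

lemma abs_tanh_mul_le_one {x c : ℝ} (hc : |c| ≤ 1) : |Real.tanh x * c| ≤ 1 := by
  rw [abs_mul]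
  exact mul_le_one₀ (Real.abs_tanh_lt_one x).le (abs_nonneg c) hc

lemma integrable_Q_pow_mul_tanh_mul_cos {k : ℕ} (hk : 1 ≤ k) :
    Integrable fun y => Q y ^ k * (Real.tanh y * Real.cos y) :=
  integrable_Q_pow_mul hk (continuous_tanh_real.mul Real.continuous_cos)
    fun y => abs_tanh_mul_le_one (Real.abs_cos_le_one y)

lemma integrable_Q_pow_mul_tanh_mul_sin {k : ℕ} (hk : 1 ≤ k) :
    Integrable fun y => Q y ^ k * (Real.tanh y * Real.sin y) :=
  integrable_Q_pow_mul hk (continuous_tanh_real.mul Real.continuous_sin)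
    fun y => abs_tanh_mul_le_one (Real.abs_sin_le_one y)

lemma integrable_exp_neg_abs_sub_mul {a : ℝ} (ha : 0 ≤ a) (z : ℝ) {g : ℝ → ℝ}
    (hg : Integrable g) : Integrable fun y => Real.exp (-a * |y - z|) * g y := by
  refine hg.bdd_mul (c := 1) (by fun_prop) (.of_forall fun y => ?_)
  rw [Real.norm_of_nonneg (Real.exp_pos _).le, Real.exp_le_one_iff]
  nlinarith [mul_nonneg ha (abs_nonneg (y - z))]

/-- On the right of `z`, the integrand in Green's identity is an exact derivative. -/
lemma setIntegral_Ioi_exp_mul {a : ℝ} (ha : 0 ≤ a) (z : ℝ) {f f₁ f₂ : ℝ → ℝ}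
    (h₁ : ∀ y, HasDerivAt f (f₁ y) y) (h₂ : ∀ y, HasDerivAt f₁ (f₂ y) y)
    (hf : Integrable f) (hf₁ : Integrable f₁) (hf₂ : Integrable f₂) :
    ∫ y in Set.Ioi z, Real.exp (-a * |y - z|) * (f₂ y - a ^ 2 * f y) = -(f₁ z + a * f z) := by
  have hcongr (g : ℝ → ℝ) : Set.EqOn (fun y => Real.exp (-a * |y - z|) * g y)
      (fun y => Real.exp (-a * (y - z)) * g y) (Set.Ioi z) := fun y hy => by
    simp only [abs_of_pos (sub_pos.2 (Set.mem_Ioi.1 hy))]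
  have hint {g : ℝ → ℝ} (hg : Integrable g) :
      IntegrableOn (fun y => Real.exp (-a * (y - z)) * g y) (Set.Ioi z) :=
    (integrable_exp_neg_abs_sub_mul ha z hg).integrableOn.congr_fun (hcongr g) measurableSet_Ioi
  have hderiv (y : ℝ) : HasDerivAt (fun y => Real.exp (-a * (y - z)) * (f₁ y + a * f y))
      (Real.exp (-a * (y - z)) * (f₂ y - a ^ 2 * f y)) y := by
    have he := (((hasDerivAt_id y).sub_const z).const_mul (-a)).exp
    refine (he.mul ((h₂ y).add ((h₁ y).const_mul a))).congr_deriv ?_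
    simp only [id, Pi.add_apply]
    ring
  have hF := hint (hf₁.add (hf.const_mul a))
  have hF' := hint (hf₂.sub (hf.const_mul (a ^ 2)))
  rw [setIntegral_congr_fun measurableSet_Ioi (hcongr fun y => f₂ y - a ^ 2 * f y),
    integral_Ioi_of_hasDerivAt_of_tendsto' (fun y _ => hderiv y) hF'
      (tendsto_zero_of_hasDerivAt_of_integrableOn_Ioi (fun y _ => hderiv y) hF' hF)]
  simp

/-- Green's identity for the kernel of `(d/dy)² - a²`. -/
lemma integral_exp_neg_abs_sub_mul {a : ℝ} (ha : 0 ≤ a) (z : ℝ) {f f₁ f₂ : ℝ → ℝ}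
    (h₁ : ∀ y, HasDerivAt f (f₁ y) y) (h₂ : ∀ y, HasDerivAt f₁ (f₂ y) y)
    (hf : Integrable f) (hf₁ : Integrable f₁) (hf₂ : Integrable f₂) :
    ∫ y, Real.exp (-a * |y - z|) * (f₂ y - a ^ 2 * f y) = -(2 * a * f z) := by
  have hg : Integrable fun y => Real.exp (-a * |y - z|) * (f₂ y - a ^ 2 * f y) :=
    integrable_exp_neg_abs_sub_mul ha z (hf₂.sub (hf.const_mul (a ^ 2)))
  have hleft := setIntegral_Ioi_exp_mul ha (-z) (f := fun y => f (-y)) (f₁ := fun y => -f₁ (-y))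
    (f₂ := fun y => f₂ (-y))
    (fun y => ((h₁ (-y)).comp y (hasDerivAt_neg y)).congr_deriv (by ring))
    (fun y => ((h₂ (-y)).comp y (hasDerivAt_neg y)).neg.congr_deriv (by ring))
    hf.comp_neg hf₁.comp_neg.neg hf₂.comp_neg
  have hreflect := integral_comp_neg_Ioi (-z)
    fun y => Real.exp (-a * |y - z|) * (f₂ y - a ^ 2 * f y)
  have habs (y : ℝ) : |-y - z| = |y - -z| := by rw [← abs_neg]; congr 1; ring
  simp only [habs, neg_neg] at hreflect hleft
  rw [← intervalIntegral.integral_Iic_add_Ioi (b := z) hg.integrableOn hg.integrableOn,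
    setIntegral_Ioi_exp_mul ha z h₁ h₂ hf hf₁ hf₂, ← hreflect, hleft]
  ring

lemma integrable_Q_sq : Integrable fun z => Q z ^ 2 := by
  simpa using integrable_Q_pow_mul one_le_two (b := fun _ => 1) continuous_const (by simp)

lemma integrable_prod_kernel {g : ℝ → ℝ} (hg : Integrable g) :
    Integrable (fun x : ℝ × ℝ => Real.exp (-(Real.sqrt 2) * |x.1 - x.2|) * Q x.2 ^ 2 * g x.1)
      (volume.prod volume) := by
  have h := hg.mul_prod integrable_Q_sq
  refine (h.bdd_mul (f := fun x : ℝ × ℝ => Real.exp (-(Real.sqrt 2) * |x.1 - x.2|)) (c := 1)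
    (by fun_prop) (.of_forall fun x => ?_)).congr (.of_forall fun x => by ring)
  rw [Real.norm_of_nonneg (Real.exp_pos _).le, Real.exp_le_one_iff]
  nlinarith [mul_nonneg (Real.sqrt_nonneg 2) (abs_nonneg (x.1 - x.2))]

lemma integrable_t2_mul {g : ℝ → ℝ} (hg : Integrable g) : Integrable fun y => t2 y * g y := by
  refine ((integrable_prod_kernel hg).integral_prod_left.const_mul
    (-(Real.sqrt 2 / 8))).congr (.of_forall fun y => ?_)
  simp only [t2]
  rw [integral_mul_const, mul_assoc]

/-- The weak form of `t₂'' = 2 t₂ + Q² / 2`. -/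
lemma integral_t2_mul {f f₁ f₂ : ℝ → ℝ}
    (h₁ : ∀ y, HasDerivAt f (f₁ y) y) (h₂ : ∀ y, HasDerivAt f₁ (f₂ y) y)
    (hf : Integrable f) (hf₁ : Integrable f₁) (hf₂ : Integrable f₂) :
    ∫ y, t2 y * (f₂ y - 2 * f y) = (∫ y, Q y ^ 2 * f y) / 2 := by
  have hs : Real.sqrt 2 ^ 2 = 2 := Real.sq_sqrt zero_le_two
  have hgreen (z : ℝ) : ∫ y, Real.exp (-(Real.sqrt 2) * |y - z|) * Q z ^ 2 * (f₂ y - 2 * f y)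
      = -(2 * Real.sqrt 2) * (Q z ^ 2 * f z) := by
    have h := integral_exp_neg_abs_sub_mul (Real.sqrt_nonneg 2) z h₁ h₂ hf hf₁ hf₂
    rw [hs] at h
    calc _ = ∫ y, Q z ^ 2 * (Real.exp (-(Real.sqrt 2) * |y - z|) * (f₂ y - 2 * f y)) :=
          integral_congr_ae (.of_forall fun y => by ring)
      _ = _ := by rw [integral_const_mul, h]; ring
  calc ∫ y, t2 y * (f₂ y - 2 * f y)
      = ∫ y, -(Real.sqrt 2 / 8) *
          ∫ z, Real.exp (-(Real.sqrt 2) * |y - z|) * Q z ^ 2 * (f₂ y - 2 * f y) :=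
        integral_congr_ae (.of_forall fun y => by
          simp only [t2]; rw [integral_mul_const, mul_assoc])
    _ = -(Real.sqrt 2 / 8) * ∫ z, -(2 * Real.sqrt 2) * (Q z ^ 2 * f z) := by
        rw [integral_const_mul,
          integral_integral_swap (integrable_prod_kernel (hf₂.sub (hf.const_mul 2)))]
        simp only [hgreen]
    _ = _ := by
        rw [integral_const_mul]
        linear_combination (∫ y, Q y ^ 2 * f y) / 4 * hs

lemma r_eq (k : ℕ) : r k = ∫ y, t2 y * (Q y ^ k * Real.cos y) := by
  simp only [r, mul_assoc]

lemma s_eq {k : ℕ} (hk : 1 ≤ k) :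
    s k = -∫ y, t2 y * (Q y ^ k * (Real.tanh y * Real.sin y)) := by
  obtain ⟨n, rfl⟩ := Nat.exists_eq_add_of_le' hk
  rw [s, ← integral_neg]
  refine integral_congr_ae (.of_forall fun y => ?_)
  simp only [(hasDerivAt_Q_s15 y).deriv, Nat.add_sub_cancel]
  ring

lemma integral_Q_pow_mul_tanh_mul_sin {k : ℕ} (hk : 1 ≤ k) :
    k * ∫ y, Q y ^ k * (Real.tanh y * Real.sin y) = p k := by
  have hd (y : ℝ) : HasDerivAt (fun y => Q y ^ k * Real.sin y)
      (Q y ^ k * Real.cos y - k * (Q y ^ k * (Real.tanh y * Real.sin y))) y :=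
    ((hasDerivAt_Q_pow k y).mul (Real.hasDerivAt_sin y)).congr_deriv (by ring)
  have hT := (integrable_Q_pow_mul_tanh_mul_sin hk).const_mul (k : ℝ)
  have h := integral_eq_zero_of_hasDerivAt_of_integrable hd
    ((integrable_Q_pow_mul_cos hk).sub hT) (integrable_Q_pow_mul_sin hk)
  rw [integral_sub (integrable_Q_pow_mul_cos hk) hT, integral_const_mul] at h
  rw [p]
  linarith

lemma r_recurrence {k : ℕ} (hk : 1 ≤ k) :
    ((k : ℝ) ^ 2 - 3) * r k - k * (k + 1) / 2 * r (k + 2) - 2 * k * s k = p (k + 2) / 2 := by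
  have hk2 : 1 ≤ k + 2 := by omega
  have hc := integrable_Q_pow_mul_cos hk
  have hc2 := integrable_Q_pow_mul_cos hk2
  have hs := integrable_Q_pow_mul_sin hk
  have hTc := integrable_Q_pow_mul_tanh_mul_cos hk
  have hTs := integrable_Q_pow_mul_tanh_mul_sin hk
  have h := integral_t2_mul (f := fun y => Q y ^ k * Real.cos y)
    (f₁ := fun y => -(k : ℝ) * (Q y ^ k * (Real.tanh y * Real.cos y)) - Q y ^ k * Real.sin y)
    (f₂ := fun y => ((k : ℝ) ^ 2 - 1) * (Q y ^ k * Real.cos y)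
      - (k : ℝ) * (k + 1) / 2 * (Q y ^ (k + 2) * Real.cos y)
      + 2 * (k : ℝ) * (Q y ^ k * (Real.tanh y * Real.sin y)))
    (fun y => ((hasDerivAt_Q_pow k y).mul (Real.hasDerivAt_cos y)).congr_deriv (by ring))
    (fun y => by
      refine ((((hasDerivAt_Q_pow k y).mul
        ((hasDerivAt_tanh_Q y).mul (Real.hasDerivAt_cos y))).const_mul (-(k : ℝ))).sub
        ((hasDerivAt_Q_pow k y).mul (Real.hasDerivAt_sin y))).congr_deriv ?_
      simp only [Pi.mul_apply]
      linear_combination (k : ℝ) ^ 2 * Q y ^ k * Real.cos y * tanh_sq_eq y)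
    hc ((hTc.const_mul _).sub hs) (((hc.const_mul _).sub (hc2.const_mul _)).add (hTs.const_mul _))
  have i1 := (integrable_t2_mul hc).const_mul ((k : ℝ) ^ 2 - 3)
  have i2 := (integrable_t2_mul hc2).const_mul ((k : ℝ) * (k + 1) / 2)
  have i3 := (integrable_t2_mul hTs).const_mul (2 * (k : ℝ))
  rw [r_eq, r_eq, s_eq hk, p]
  calc _ = ∫ y, ((k : ℝ) ^ 2 - 3) * (t2 y * (Q y ^ k * Real.cos y))
        - (k : ℝ) * (k + 1) / 2 * (t2 y * (Q y ^ (k + 2) * Real.cos y))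
        + 2 * (k : ℝ) * (t2 y * (Q y ^ k * (Real.tanh y * Real.sin y))) := by
        rw [integral_add (i1.sub' i2) i3, integral_sub i1 i2]
        simp only [integral_const_mul]
        ring
    _ = (∫ y, Q y ^ 2 * (Q y ^ k * Real.cos y)) / 2 := by
        rw [← h]
        exact integral_congr_ae (.of_forall fun y => by ring)
    _ = _ := by
        congr 1
        exact integral_congr_ae (.of_forall fun y => by ring)

lemma s_recurrence {k : ℕ} (hk : 1 ≤ k) :
    ((k : ℝ) ^ 2 - 3) * s k + 2 * k * r k - (k + 1) * r (k + 2)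
      - (k + 1) * (k + 2) / 2 * s (k + 2) = -(p (k + 2) / (2 * (k + 2))) := by
  have hk2 : 1 ≤ k + 2 := by omega
  have hc := integrable_Q_pow_mul_cos hk
  have hc2 := integrable_Q_pow_mul_cos hk2
  have hs := integrable_Q_pow_mul_sin hk
  have hs2 := integrable_Q_pow_mul_sin hk2
  have hTc := integrable_Q_pow_mul_tanh_mul_cos hk
  have hTs := integrable_Q_pow_mul_tanh_mul_sin hk
  have hTs2 := integrable_Q_pow_mul_tanh_mul_sin hk2
  have h := integral_t2_mul (f := fun y => Q y ^ k * (Real.tanh y * Real.sin y))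
    (f₁ := fun y => -(k : ℝ) * (Q y ^ k * Real.sin y)
      + ((k : ℝ) + 1) / 2 * (Q y ^ (k + 2) * Real.sin y)
      + Q y ^ k * (Real.tanh y * Real.cos y))
    (f₂ := fun y => ((k : ℝ) ^ 2 - 1) * (Q y ^ k * (Real.tanh y * Real.sin y))
      - 2 * (k : ℝ) * (Q y ^ k * Real.cos y)
      + ((k : ℝ) + 1) * (Q y ^ (k + 2) * Real.cos y)
      - ((k : ℝ) + 1) * (k + 2) / 2 * (Q y ^ (k + 2) * (Real.tanh y * Real.sin y)))
    (fun y => by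
      refine ((hasDerivAt_Q_pow k y).mul
        ((hasDerivAt_tanh_Q y).mul (Real.hasDerivAt_sin y))).congr_deriv ?_
      simp only [Pi.mul_apply]
      linear_combination -(k : ℝ) * Q y ^ k * Real.sin y * tanh_sq_eq y)
    (fun y => by
      refine (((((hasDerivAt_Q_pow k y).mul (Real.hasDerivAt_sin y)).const_mul (-(k : ℝ))).add
        (((hasDerivAt_Q_pow (k + 2) y).mul (Real.hasDerivAt_sin y)).const_mul
          (((k : ℝ) + 1) / 2))).add
        ((hasDerivAt_Q_pow k y).mul
          ((hasDerivAt_tanh_Q y).mul (Real.hasDerivAt_cos y)))).congr_deriv ?_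
      simp only [Pi.mul_apply]
      push_cast
      linear_combination -(k : ℝ) * Q y ^ k * Real.cos y * tanh_sq_eq y)
    hTs (((hs.const_mul _).add (hs2.const_mul _)).add hTc)
    ((((hTs.const_mul _).sub (hc.const_mul _)).add (hc2.const_mul _)).sub (hTs2.const_mul _))
  have i1 := (integrable_t2_mul hTs).const_mul ((k : ℝ) ^ 2 - 3)
  have i2 := (integrable_t2_mul hc).const_mul (2 * (k : ℝ))
  have i3 := (integrable_t2_mul hc2).const_mul ((k : ℝ) + 1)
  have i4 := (integrable_t2_mul hTs2).const_mul (((k : ℝ) + 1) * (k + 2) / 2)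
  rw [r_eq, r_eq, s_eq hk, s_eq hk2, ← integral_Q_pow_mul_tanh_mul_sin hk2]
  calc _ = -∫ y, ((k : ℝ) ^ 2 - 3) * (t2 y * (Q y ^ k * (Real.tanh y * Real.sin y)))
        - 2 * (k : ℝ) * (t2 y * (Q y ^ k * Real.cos y))
        + ((k : ℝ) + 1) * (t2 y * (Q y ^ (k + 2) * Real.cos y))
        - ((k : ℝ) + 1) * (k + 2) / 2
          * (t2 y * (Q y ^ (k + 2) * (Real.tanh y * Real.sin y))) := by
        rw [integral_sub ((i1.sub' i2).fun_add i3) i4, integral_add (i1.sub' i2) i3, integral_sub i1 i2]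
        simp only [integral_const_mul]
        ring
    _ = -((∫ y, Q y ^ 2 * (Q y ^ k * (Real.tanh y * Real.sin y))) / 2) := by
        rw [← h]
        congr 1
        exact integral_congr_ae (.of_forall fun y => by ring)
    _ = -((∫ y, Q y ^ (k + 2) * (Real.tanh y * Real.sin y)) / 2) := by
        congr 2
        exact integral_congr_ae (.of_forall fun y => by ring)
    _ = _ := by
        push_cast
        field_simp

theorem stmt15 :
    ∀ k : ℕ, 1 ≤ k →
      r (k + 2) = (2 / ((k : ℝ) * ((k : ℝ) + 1))) *
          (((k : ℝ) ^ 2 - 3) * r k - 2 * (k : ℝ) * s k - p (k + 2) / 2) ∧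
      s (k + 2) = (2 / (((k : ℝ) + 1) * ((k : ℝ) + 2))) *
          (((k : ℝ) ^ 2 - 3) * s k + 2 * (k : ℝ) * r k - ((k : ℝ) + 1) * r (k + 2)
            + p (k + 2) / (2 * ((k : ℝ) + 2))) := by
  intro k hk
  have hk0 : (0 : ℝ) < k := by exact_mod_cast hk
  constructor
  · rw [div_mul_eq_mul_div, eq_div_iff (by positivity)]
    linear_combination -2 * r_recurrence hk
  · rw [div_mul_eq_mul_div, eq_div_iff (by positivity)]
    linear_combination -2 * s_recurrence hk
end
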